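/- Let d ≥ 1, 1 < p < ∞, δ ∈ ℝ, let m ≥ 0 be an integer with mp > d, and let k be a nonnegative integer with k < m − d/p. Then there exists a constant C = C(d,m,p,k,δ) such that every f ∈ C^m(ℝ^d) with ‖f‖_{H^{m,p}_δ} := Σ_{|α|≤m} ‖⟨x⟩^δ D^α f‖_{L^p(ℝ^d)} < ∞ satisfies, for every multi-index α with |α| ≤ k: (i) sup_{x∈ℝ^d} ⟨x⟩^δ |D^α f(x)| ≤ C · ‖f‖_{H^{m,p}_δ}, and (ii) |x|^δ |D^α f(x)| → 0 as |x| → ∞. -/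

import Mathlib

open MeasureTheory Filter
open scoped BigOperators ENNReal Topology

noncomputable section

/-- The Japanese bracket `⟨x⟩ = (1+|x|²)^{1/2}`. -/
def jb {d : ℕ} (x : EuclideanSpace ℝ (Fin d)) : ℝ := Real.sqrt (1 + ‖x‖ ^ 2)

/-- The partial derivative in the `i`-th coordinate direction. -/
def pd {d : ℕ} {F : Type*} [NormedAddCommGroup F] [NormedSpace ℝ F] (i : Fin d)
    (f : EuclideanSpace ℝ (Fin d) → F) : EuclideanSpace ℝ (Fin d) → F :=
  fun x => fderiv ℝ f x (EuclideanSpace.single i 1)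

/-- Iterated partial derivatives along a list of coordinate directions. -/
def pdList {d : ℕ} {F : Type*} [NormedAddCommGroup F] [NormedSpace ℝ F] :
    List (Fin d) → (EuclideanSpace ℝ (Fin d) → F) → EuclideanSpace ℝ (Fin d) → F
  | [], f => f
  | i :: l, f => pd i (pdList l f)

/-- The partial derivative `D^α f` corresponding to a multi-index `α : Fin d → ℕ`. -/
def mD {d : ℕ} {F : Type*} [NormedAddCommGroup F] [NormedSpace ℝ F] (α : Fin d → ℕ)
    (f : EuclideanSpace ℝ (Fin d) → F) : EuclideanSpace ℝ (Fin d) → F :=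
  pdList ((List.finRange d).flatMap fun i => List.replicate (α i) i) f

/-- The order `|α|` of a multi-index. -/
def msize {d : ℕ} (α : Fin d → ℕ) : ℕ := ∑ i, α i

/-- The finset of all multi-indices on `ℝ^d` of order at most `m`. -/
def mIdx (d m : ℕ) : Finset (Fin d → ℕ) :=
  (Fintype.piFinset fun _ : Fin d => Finset.range (m + 1)).filter fun α => msize α ≤ m

theorem contDiff_pd {d n : ℕ} (i : Fin d) {f : EuclideanSpace ℝ (Fin d) → ℝ}
    (hf : ContDiff ℝ (n + 1 : ℕ) f) : ContDiff ℝ n (pd i f) :=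
  (hf.fderiv_right (m := n) (by norm_cast)).clm_apply contDiff_const

theorem contDiff_pdList {d : ℕ} {f : EuclideanSpace ℝ (Fin d) → ℝ} (l : List (Fin d)) :
    ∀ n : ℕ, ContDiff ℝ (n + l.length : ℕ) f → ContDiff ℝ n (pdList l f) := by
  induction l with
  | nil => intro n hf; simpa [pdList] using hf
  | cons i l ih =>
    intro n hf
    refine contDiff_pd i (ih (n + 1) ?_)
    have : n + 1 + l.length = n + (i :: l).length := by simp; ring
    rwa [this]

theorem pd_comm {d : ℕ} (i j : Fin d) {f : EuclideanSpace ℝ (Fin d) → ℝ}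
    (hf : ContDiff ℝ 2 f) : pd i (pd j f) = pd j (pd i f) := by
  have h (i j : Fin d) (x) : pd i (pd j f) x =
      fderiv ℝ (fderiv ℝ f) x (EuclideanSpace.single i 1) (EuclideanSpace.single j 1) := by
    have hd : DifferentiableAt ℝ (fderiv ℝ f) x :=
      ((hf.fderiv_right (m := 1) (by norm_num)).differentiable (by norm_num)) x
    unfold pd
    rw [fderiv_clm_apply hd (differentiableAt_const _)]
    simp
  ext x
  rw [h, h]
  exact (hf.contDiffAt.isSymmSndFDerivAt (by simp)) _ _

theorem pdList_perm {d : ℕ} {f : EuclideanSpace ℝ (Fin d) → ℝ} {l l' : List (Fin d)}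
    (h : l.Perm l') : ContDiff ℝ l.length f → pdList l f = pdList l' f := by
  induction h with
  | nil => intro _; rfl
  | cons i _ ih =>
    intro hf
    simp only [pdList]
    rw [ih (hf.of_le (by simp))]
  | swap i j l =>
    intro hf
    refine pd_comm j i (contDiff_pdList l 2 (hf.of_le ?_))
    simp only [List.length_cons]
    norm_cast
    omega
  | trans h₁ _ ih₁ ih₂ =>
    intro hf
    rw [ih₁ hf, ih₂ (by rwa [← h₁.length_eq])]

/-- Every iterated partial derivative is a multi-index derivative. -/
theorem pdList_eq_mD {d : ℕ} {f : EuclideanSpace ℝ (Fin d) → ℝ} (l : List (Fin d))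
    (hf : ContDiff ℝ l.length f) : pdList l f = mD (fun i => l.count i) f := by
  refine pdList_perm ?_ hf
  rw [List.perm_iff_count]
  intro a
  rw [List.count_flatMap]
  rw [← Fin.sum_univ_def]
  simp [List.count_replicate]

theorem mem_mIdx {d m : ℕ} {α : Fin d → ℕ} : α ∈ mIdx d m ↔ msize α ≤ m := by
  simp only [mIdx, Finset.mem_filter, Fintype.mem_piFinset, Finset.mem_range, Nat.lt_succ_iff,
    and_iff_right_iff_imp]
  exact fun h i => (Finset.single_le_sum (fun _ _ => Nat.zero_le _) (Finset.mem_univ i)).trans h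

theorem msize_count {d : ℕ} (l : List (Fin d)) : msize (fun i => l.count i) = l.length := by
  simpa [msize] using Multiset.sum_count_eq_card (s := Finset.univ) (m := (l : Multiset (Fin d)))

theorem length_multiIndexList {d : ℕ} (α : Fin d → ℕ) :
    ((List.finRange d).flatMap fun i => List.replicate (α i) i).length = msize α := by
  simp [List.length_flatMap, msize, Fin.sum_univ_def]

/-- The `i`-th iterate of the directional derivative `y · ∇`, applied to `pdList l f`. -/
def dirDeriv {d : ℕ} (f : EuclideanSpace ℝ (Fin d) → ℝ) (y : EuclideanSpace ℝ (Fin d)) :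
    ℕ → List (Fin d) → EuclideanSpace ℝ (Fin d) → ℝ
  | 0, l, z => pdList l f z
  | i + 1, l, z => ∑ a, y a * dirDeriv f y i (a :: l) z

theorem hasDerivAt_dirDeriv {d m : ℕ} {f : EuclideanSpace ℝ (Fin d) → ℝ} (hf : ContDiff ℝ m f)
    (x y : EuclideanSpace ℝ (Fin d)) (s : ℝ) :
    ∀ (i : ℕ) (l : List (Fin d)), l.length + i + 1 ≤ m →
      HasDerivAt (fun s : ℝ => dirDeriv f y i l (x + s • y)) (dirDeriv f y (i + 1) l (x + s • y)) s
  | 0, l, h => by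
    have hl : ContDiff ℝ 1 (pdList l f) :=
      contDiff_pdList l 1 (hf.of_le (by norm_cast; omega))
    have h1 := (hl.differentiable (by norm_num) (x + s • y)).hasFDerivAt
    have h2 : HasDerivAt (fun s : ℝ => x + s • y) y s := by
      simpa using ((hasDerivAt_id s).smul_const y).const_add x
    refine (h1.comp_hasDerivAt s h2).congr_deriv ?_
    generalize x + s • y = z
    have hy : y = ∑ a, y a • EuclideanSpace.single a (1 : ℝ) := by
      ext b
      simp [Pi.single_apply]
    conv_lhs => rw [hy]
    simp only [dirDeriv, map_sum, map_smul, pdList, pd, smul_eq_mul]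
  | i + 1, l, h => by
    refine HasDerivAt.fun_sum fun a _ => ?_
    exact (hasDerivAt_dirDeriv hf x y s i (a :: l) (by simp; omega)).const_mul _

theorem continuous_dirDeriv {d m : ℕ} {f : EuclideanSpace ℝ (Fin d) → ℝ} (hf : ContDiff ℝ m f)
    (y : EuclideanSpace ℝ (Fin d)) :
    ∀ (i : ℕ) (l : List (Fin d)), l.length + i ≤ m → Continuous (dirDeriv f y i l)
  | 0, l, h => (contDiff_pdList l 0 (hf.of_le (by norm_cast; omega))).continuous
  | i + 1, l, h => continuous_finsetSum _ fun a _ => continuous_const.mul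
      (continuous_dirDeriv hf y i (a :: l) (by simp; omega))

theorem abs_dirDeriv_le {d m : ℕ} {f : EuclideanSpace ℝ (Fin d) → ℝ} (hf : ContDiff ℝ m f)
    {y : EuclideanSpace ℝ (Fin d)} (hy : ‖y‖ ≤ 1) (z : EuclideanSpace ℝ (Fin d)) :
    ∀ (i : ℕ) (l : List (Fin d)), l.length + i ≤ m →
      |dirDeriv f y i l z| ≤ (d : ℝ) ^ i * ∑ β ∈ mIdx d m, |mD β f z|
  | 0, l, h => by
    have hl := pdList_eq_mD l (hf.of_le (by norm_cast))
    simp only [dirDeriv, hl, pow_zero, one_mul]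
    exact Finset.single_le_sum (f := fun β => |mD β f z|) (fun _ _ => abs_nonneg _)
      (mem_mIdx.2 ((msize_count l).trans_le h))
  | i + 1, l, h => by
    have hb (a : Fin d) : |y a * dirDeriv f y i (a :: l) z| ≤
        (d : ℝ) ^ i * ∑ β ∈ mIdx d m, |mD β f z| := by
      rw [abs_mul]
      have := abs_dirDeriv_le hf hy z i (a :: l) (by simp; omega)
      have hya : |y a| ≤ 1 := (PiLp.norm_apply_le y a).trans hy
      exact (mul_le_of_le_one_left (abs_nonneg _) hya).trans this
    calc |dirDeriv f y (i + 1) l z| ≤ ∑ a, |y a * dirDeriv f y i (a :: l) z| :=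
          Finset.abs_sum_le_sum_abs _ _
      _ ≤ ∑ _a : Fin d, (d : ℝ) ^ i * ∑ β ∈ mIdx d m, |mD β f z| :=
          Finset.sum_le_sum fun a _ => hb a
      _ = _ := by simp; ring

/-- Taylor's formula at `0`, expanded around `1`, with integral remainder. -/
theorem abs_le_sum_add_abs_integral {n : ℕ} {g : ℕ → ℝ → ℝ}
    (hg : ∀ i ≤ n, ∀ s, HasDerivAt (g i) (g (i + 1) s) s) (hc : Continuous (g (n + 1))) :
    |g 0 0| ≤ ∑ i ∈ Finset.range (n + 1), |g i 1| + |∫ s in (0 : ℝ)..1, s ^ n * g (n + 1) s| := by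
  induction n with
  | zero =>
    have := intervalIntegral.integral_eq_sub_of_hasDerivAt (a := 0) (b := 1)
      (fun s _ => hg 0 le_rfl s) (hc.intervalIntegrable _ _)
    simp only [zero_add, Finset.range_one, Finset.sum_singleton, pow_zero, one_mul] at this ⊢
    rw [this]
    have := abs_sub_abs_le_abs_sub (g 0 0) (g 0 1)
    rw [abs_sub_comm] at this
    linarith
  | succ n ih =>
    have hc' : Continuous (g (n + 1)) :=
      continuous_iff_continuousAt.2 fun s => (hg (n + 1) le_rfl s).continuousAt
    refine (ih (fun i hi => hg i (by omega)) hc').trans ?_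
    have h := intervalIntegral.integral_mul_deriv_eq_deriv_mul (a := 0) (b := 1)
      (u := fun s : ℝ => s ^ (n + 1)) (u' := fun s : ℝ => (n + 1 : ℝ) * s ^ n)
      (v := g (n + 1)) (v' := g (n + 2))
      (fun s _ => by simpa using hasDerivAt_pow (n + 1) s) (fun s _ => hg (n + 1) le_rfl s)
      (Continuous.intervalIntegrable (by fun_prop) _ _) (hc.intervalIntegrable _ _)
    simp only [one_pow, one_mul, mul_assoc, intervalIntegral.integral_const_mul, ne_eq,
      Nat.add_eq_zero_iff, one_ne_zero, and_false, not_false_eq_true, zero_pow, zero_mul,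
      sub_zero] at h
    rw [Finset.sum_range_succ _ (n + 1), add_assoc]
    gcongr
    set I := ∫ s in (0 : ℝ)..1, s ^ n * g (n + 1) s
    have hI : ((n : ℝ) + 1) * I = g (n + 1) 1 - ∫ s in (0 : ℝ)..1, s ^ (n + 1) * g (n + 2) s := by
      linarith
    calc |I| ≤ |((n : ℝ) + 1) * I| := by
          rw [abs_mul]
          refine le_mul_of_one_le_left (abs_nonneg _) ?_
          rw [abs_of_nonneg (by positivity)]
          simp
      _ ≤ _ := by rw [hI]; exact abs_sub _ _

theorem lintegral_comp_add_smul {d : ℕ} {F : EuclideanSpace ℝ (Fin d) → ℝ≥0∞} (hF : Measurable F)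
    (x : EuclideanSpace ℝ (Fin d)) {s : ℝ} (hs : 0 < s) :
    ∫⁻ y, F (x + s • y) = ENNReal.ofReal (s ^ (-(d : ℝ))) * ∫⁻ y, F y := by
  have h := lintegral_map (μ := (volume : Measure (EuclideanSpace ℝ (Fin d))))
    (f := fun z => F (x + z)) (g := fun y => s • y) (by fun_prop) (by fun_prop)
  rw [← h, Measure.map_addHaar_smul _ hs.ne', lintegral_smul_measure,
    lintegral_add_left_eq_self F x, finrank_euclideanSpace_fin, abs_of_pos (by positivity),
    Real.rpow_neg hs.le, Real.rpow_natCast, smul_eq_mul]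

theorem setLIntegral_ball_comp_add_smul_le {d : ℕ} {p q : ℝ} (hpq : p.HolderConjugate q)
    {V : EuclideanSpace ℝ (Fin d) → ℝ≥0∞} (hV : Measurable V)
    (x : EuclideanSpace ℝ (Fin d)) {s : ℝ} (hs : 0 < s) (hs1 : s ≤ 1) :
    ∫⁻ y in Metric.ball 0 1, V (x + s • y) ≤
      ENNReal.ofReal (s ^ (-(d : ℝ) / p)) * (∫⁻ y in Metric.ball x 1, V y ^ p) ^ (1 / p) *
        volume (Metric.ball (0 : EuclideanSpace ℝ (Fin d)) 1) ^ (1 / q) := by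
  have hp := hpq.pos
  have h := ENNReal.lintegral_mul_le_Lp_mul_Lq
    (volume.restrict (Metric.ball (0 : EuclideanSpace ℝ (Fin d)) 1)) hpq
    (f := fun y => V (x + s • y)) (g := fun _ => 1) (by fun_prop) aemeasurable_const
  simp only [Pi.mul_apply, mul_one, ENNReal.one_rpow, lintegral_const, one_mul,
    Measure.restrict_apply_univ] at h
  refine h.trans ?_
  gcongr
  have hsub : ∫⁻ y in Metric.ball 0 1, V (x + s • y) ^ p ≤
      ENNReal.ofReal (s ^ (-(d : ℝ))) * ∫⁻ y in Metric.ball x 1, V y ^ p := by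
    rw [← lintegral_indicator measurableSet_ball, ← lintegral_indicator measurableSet_ball,
      ← lintegral_comp_add_smul ((hV.pow_const p).indicator measurableSet_ball) x hs]
    refine lintegral_mono fun y => ?_
    by_cases hy : y ∈ Metric.ball (0 : EuclideanSpace ℝ (Fin d)) 1
    · have hmem : x + s • y ∈ Metric.ball x 1 := by
        rw [mem_ball_zero_iff] at hy
        rw [mem_ball_iff_norm, add_sub_cancel_left, norm_smul, Real.norm_of_nonneg hs.le]
        nlinarith [norm_nonneg y]
      simp [Set.indicator_of_mem, hy, hmem]
    · simp [Set.indicator_of_notMem hy]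
  calc (∫⁻ y in Metric.ball 0 1, V (x + s • y) ^ p) ^ (1 / p)
      ≤ (ENNReal.ofReal (s ^ (-(d : ℝ))) * ∫⁻ y in Metric.ball x 1, V y ^ p) ^ (1 / p) := by gcongr
    _ = _ := by
      rw [ENNReal.mul_rpow_of_nonneg _ _ (by positivity),
        ENNReal.ofReal_rpow_of_nonneg (by positivity) (by positivity), ← Real.rpow_mul hs.le,
        mul_one_div]

/-- A function value controlled by unit-scale averages and scaled remainders is controlled by the
`L^p` norm on the unit ball, provided the remainder kernel is integrable. -/
theorem exists_const_mul_Lp_ball {d n : ℕ} {p : ℝ} (hp : 1 < p) (hn : (d : ℝ) / p < n + 1)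
    {K : ℝ≥0∞} (hK : K ≠ ∞) :
    ∃ C : ℝ≥0∞, C ≠ ∞ ∧ ∀ (V : EuclideanSpace ℝ (Fin d) → ℝ≥0∞), Measurable V →
      ∀ (c : ℝ≥0∞) (x : EuclideanSpace ℝ (Fin d)),
      (∀ y ∈ Metric.ball (0 : EuclideanSpace ℝ (Fin d)) 1,
        c ≤ K * (V (x + y) + ∫⁻ s in Set.Ioc (0 : ℝ) 1, ENNReal.ofReal (s ^ n) * V (x + s • y))) →
      c ≤ C * (∫⁻ y in Metric.ball x 1, V y ^ p) ^ (1 / p) := by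
  obtain ⟨q, hpq⟩ : ∃ q, p.HolderConjugate q := ⟨_, Real.HolderConjugate.conjExponent hp⟩
  set B := Metric.ball (0 : EuclideanSpace ℝ (Fin d)) 1
  have hB0 : volume B ≠ 0 := (Metric.measure_ball_pos _ _ one_pos).ne'
  have hBt : volume B ≠ ∞ := measure_ball_lt_top.ne
  set A := volume B ^ (1 / q)
  have hA : A ≠ ∞ := ENNReal.rpow_ne_top_of_nonneg (by have := hpq.symm.pos; positivity) hBt
  set J := ∫⁻ s in Set.Ioc (0 : ℝ) 1, ENNReal.ofReal (s ^ n) * ENNReal.ofReal (s ^ (-(d : ℝ) / p))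
  have hJ : J ≠ ∞ := by
    have hi : IntervalIntegrable (fun s : ℝ => s ^ ((n : ℝ) + -(d : ℝ) / p)) volume 0 1 :=
      intervalIntegral.intervalIntegrable_rpow' (by rw [neg_div]; linarith)
    rw [intervalIntegrable_iff_integrableOn_Ioc_of_le zero_le_one] at hi
    have : J = ∫⁻ s in Set.Ioc (0 : ℝ) 1, ENNReal.ofReal (s ^ ((n : ℝ) + -(d : ℝ) / p)) := by
      refine setLIntegral_congr_fun measurableSet_Ioc fun s hs => ?_
      have := hs.1
      rw [← ENNReal.ofReal_mul (by positivity), Real.rpow_add this, Real.rpow_natCast]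
    rw [this]
    exact hi.lintegral_lt_top.ne
  refine ⟨(volume B)⁻¹ * (K * (A + J * A)), by finiteness, fun V hV c x hc => ?_⟩
  set N := (∫⁻ y in Metric.ball x 1, V y ^ p) ^ (1 / p)
  have h1 : ∫⁻ y in B, V (x + y) ≤ A * N := by
    have := setLIntegral_ball_comp_add_smul_le hpq hV x one_pos le_rfl
    rw [mul_comm]
    simpa only [one_smul, Real.one_rpow, ENNReal.ofReal_one, one_mul] using this
  have hmeas : Measurable fun z : EuclideanSpace ℝ (Fin d) × ℝ =>
      ENNReal.ofReal (z.2 ^ n) * V (x + z.2 • z.1) := by fun_prop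
  have h2 : ∫⁻ y in B, ∫⁻ s in Set.Ioc (0 : ℝ) 1, ENNReal.ofReal (s ^ n) * V (x + s • y) ≤
      J * A * N := by
    rw [lintegral_lintegral_swap hmeas.aemeasurable, mul_assoc,
      ← lintegral_mul_const _ (by fun_prop)]
    refine setLIntegral_mono' measurableSet_Ioc fun s hs => ?_
    rw [lintegral_const_mul _ (by fun_prop), mul_assoc, mul_comm A, ← mul_assoc _ N]
    gcongr
    exact setLIntegral_ball_comp_add_smul_le hpq hV x hs.1 hs.2
  have h3 : volume B * c ≤ K * (A + J * A) * N := by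
    calc volume B * c = ∫⁻ _y in B, c := by simp [mul_comm]
      _ ≤ ∫⁻ y in B, K * (V (x + y) +
          ∫⁻ s in Set.Ioc (0 : ℝ) 1, ENNReal.ofReal (s ^ n) * V (x + s • y)) :=
        setLIntegral_mono' measurableSet_ball hc
      _ = K * ((∫⁻ y in B, V (x + y)) + ∫⁻ y in B,
          ∫⁻ s in Set.Ioc (0 : ℝ) 1, ENNReal.ofReal (s ^ n) * V (x + s • y)) := by
        rw [lintegral_const_mul' _ _ hK, lintegral_add_left (by fun_prop)]
      _ ≤ K * (A * N + J * A * N) := by gcongr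
      _ = _ := by ring
  calc c = (volume B)⁻¹ * (volume B * c) := by
        rw [← mul_assoc, ENNReal.inv_mul_cancel hB0 hBt, one_mul]
    _ ≤ (volume B)⁻¹ * (K * (A + J * A) * N) := by gcongr
    _ = _ := by ring

theorem continuous_mD {d m : ℕ} {f : EuclideanSpace ℝ (Fin d) → ℝ} (hf : ContDiff ℝ m f)
    {β : Fin d → ℕ} (hβ : β ∈ mIdx d m) : Continuous (mD β f) := by
  refine (contDiff_pdList _ 0 (hf.of_le ?_)).continuous
  rw [length_multiIndexList, zero_add]
  exact_mod_cast mem_mIdx.1 hβ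

/-- Pointwise Taylor estimate of a derivative by the sum of all derivatives along a segment. -/
theorem ofReal_abs_pdList_le {d m n : ℕ} {f : EuclideanSpace ℝ (Fin d) → ℝ}
    (hf : ContDiff ℝ m f) (l : List (Fin d)) (hl : l.length + (n + 1) ≤ m)
    (x : EuclideanSpace ℝ (Fin d)) {y : EuclideanSpace ℝ (Fin d)} (hy : ‖y‖ ≤ 1) :
    ENNReal.ofReal |pdList l f x| ≤ ENNReal.ofReal (∑ i ∈ Finset.range (n + 2), (d : ℝ) ^ i) *
      (ENNReal.ofReal (∑ β ∈ mIdx d m, |mD β f (x + y)|) +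
        ∫⁻ s in Set.Ioc (0 : ℝ) 1, ENNReal.ofReal (s ^ n) *
          ENNReal.ofReal (∑ β ∈ mIdx d m, |mD β f (x + s • y)|)) := by
  set M : EuclideanSpace ℝ (Fin d) → ℝ := fun z => ∑ β ∈ mIdx d m, |mD β f z| with hM
  have hM0 (z) : 0 ≤ M z := Finset.sum_nonneg fun _ _ => abs_nonneg _
  set K : ℝ := ∑ i ∈ Finset.range (n + 2), (d : ℝ) ^ i with hK
  have hK0 : 0 ≤ K := by positivity
  have hline : Continuous fun s : ℝ => x + s • y := by fun_prop
  have h := abs_le_sum_add_abs_integral (n := n) (g := fun i s => dirDeriv f y i l (x + s • y))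
    (fun i hi s => hasDerivAt_dirDeriv hf x y s i l (by omega))
    ((continuous_dirDeriv hf y (n + 1) l (by omega)).comp hline)
  simp only [zero_smul, add_zero, one_smul] at h
  have h1 : ∑ i ∈ Finset.range (n + 1), |dirDeriv f y i l (x + y)| ≤ K * M (x + y) := by
    calc _ ≤ ∑ i ∈ Finset.range (n + 1), (d : ℝ) ^ i * M (x + y) :=
          Finset.sum_le_sum fun i hi =>
            abs_dirDeriv_le hf hy _ i l (by have := Finset.mem_range.1 hi; omega)
      _ = (∑ i ∈ Finset.range (n + 1), (d : ℝ) ^ i) * M (x + y) := by rw [Finset.sum_mul]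
      _ ≤ K * M (x + y) := by
        refine mul_le_mul_of_nonneg_right ?_ (hM0 _)
        rw [hK, Finset.sum_range_succ _ (n + 1)]
        exact le_add_of_nonneg_right (by positivity)
  have h2 : ENNReal.ofReal |∫ s in (0 : ℝ)..1, s ^ n * dirDeriv f y (n + 1) l (x + s • y)| ≤
      ENNReal.ofReal K * ∫⁻ s in Set.Ioc (0 : ℝ) 1, ENNReal.ofReal (s ^ n) *
        ENNReal.ofReal (M (x + s • y)) := by
    rw [← Real.enorm_eq_ofReal_abs, intervalIntegral.integral_of_le zero_le_one,
      ← lintegral_const_mul' _ _ ENNReal.ofReal_ne_top]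
    refine (enorm_integral_le_lintegral_enorm _).trans ?_
    refine setLIntegral_mono' measurableSet_Ioc fun s hs => ?_
    have hs0 : 0 ≤ s ^ n := pow_nonneg hs.1.le n
    rw [← ENNReal.ofReal_mul hs0, ← ENNReal.ofReal_mul hK0, Real.enorm_eq_ofReal_abs]
    refine ENNReal.ofReal_le_ofReal ?_
    rw [abs_mul, abs_of_nonneg hs0, mul_left_comm]
    refine mul_le_mul_of_nonneg_left
      ((abs_dirDeriv_le hf hy _ (n + 1) l (by omega)).trans ?_) hs0
    refine mul_le_mul_of_nonneg_right ?_ (hM0 _)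
    exact Finset.single_le_sum (f := fun i => (d : ℝ) ^ i) (fun _ _ => by positivity)
      (Finset.mem_range.2 (Nat.lt_succ_self _))
  calc ENNReal.ofReal |pdList l f x| ≤ ENNReal.ofReal (K * M (x + y)) +
        ENNReal.ofReal |∫ s in (0 : ℝ)..1, s ^ n * dirDeriv f y (n + 1) l (x + s • y)| := by
        refine (ENNReal.ofReal_le_ofReal (h.trans ?_)).trans ENNReal.ofReal_add_le
        gcongr
    _ ≤ _ := by
      rw [mul_add, ← ENNReal.ofReal_mul hK0]
      gcongr

theorem jb_pos {d : ℕ} (x : EuclideanSpace ℝ (Fin d)) : 0 < jb x :=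
  Real.sqrt_pos.2 (by positivity)

theorem continuous_jb_rpow {d : ℕ} (δ : ℝ) :
    Continuous fun x : EuclideanSpace ℝ (Fin d) => jb x ^ δ :=
  Continuous.rpow_const (by unfold jb; fun_prop) fun x => Or.inl (jb_pos x).ne'

theorem norm_le_jb {d : ℕ} (x : EuclideanSpace ℝ (Fin d)) : ‖x‖ ≤ jb x :=
  Real.le_sqrt_of_sq_le (by linarith)

theorem jb_le_two_mul_norm {d : ℕ} {x : EuclideanSpace ℝ (Fin d)} (hx : 1 ≤ ‖x‖) :
    jb x ≤ 2 * ‖x‖ :=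
  (Real.sqrt_le_left (by positivity)).2 (by nlinarith)

theorem jb_le_two_mul_jb {d : ℕ} {x y : EuclideanSpace ℝ (Fin d)} (h : ‖x - y‖ ≤ 1) :
    jb x ≤ 2 * jb y := by
  have hx : ‖x‖ ≤ ‖y‖ + 1 := by linarith [norm_sub_norm_le x y]
  refine (Real.sqrt_le_left (mul_nonneg zero_le_two (jb_pos y).le)).2 ?_
  rw [mul_pow, jb, Real.sq_sqrt (by positivity)]
  nlinarith [norm_nonneg x, norm_nonneg y, sq_nonneg (‖y‖ - 1)]

/-- Powers of comparable positive numbers are comparable. -/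
theorem rpow_le_two_rpow_abs_mul {a b : ℝ} (ha : 0 < a) (hb : 0 < b) (hab : a ≤ 2 * b)
    (hba : b ≤ 2 * a) (δ : ℝ) : a ^ δ ≤ 2 ^ |δ| * b ^ δ := by
  rcases le_total 0 δ with h | h
  · rw [abs_of_nonneg h, ← Real.mul_rpow zero_le_two hb.le]
    exact Real.rpow_le_rpow ha.le hab h
  · rw [abs_of_nonpos h, Real.rpow_neg zero_le_two, ← Real.inv_rpow zero_le_two,
      ← Real.mul_rpow (by positivity) hb.le]
    exact Real.rpow_le_rpow_of_nonpos (by positivity) (by linarith) h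

/-- Local weighted estimate: the weighted derivative at `x` is controlled by the weighted
`L^p` norm on the unit ball around `x`. -/
theorem exists_local_weighted_bound {d m k : ℕ} {p : ℝ} (δ : ℝ) (hp : 1 < p)
    (hk : (k : ℝ) < (m : ℝ) - (d : ℝ) / p) :
    ∃ C : ℝ≥0∞, C ≠ ∞ ∧ ∀ f : EuclideanSpace ℝ (Fin d) → ℝ, ContDiff ℝ m f →
      ∀ α ∈ mIdx d k, ∀ x, ENNReal.ofReal (jb x ^ δ * |mD α f x|) ≤
        C * (∫⁻ y in Metric.ball x 1,
          ENNReal.ofReal (∑ β ∈ mIdx d m, jb y ^ δ * |mD β f y|) ^ p) ^ (1 / p) := by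
  have hp0 : 0 < p := by linarith
  have hkm : k < m := by
    have : (0 : ℝ) ≤ d / p := by positivity
    exact_mod_cast (by linarith : (k : ℝ) < m)
  obtain ⟨n, rfl⟩ := Nat.exists_eq_add_of_lt hkm
  obtain ⟨C, hC, hbound⟩ := exists_const_mul_Lp_ball (d := d) (n := n) hp
    (by push_cast at hk; linarith)
    (K := ENNReal.ofReal (∑ i ∈ Finset.range (n + 2), (d : ℝ) ^ i)) ENNReal.ofReal_ne_top
  refine ⟨C * ENNReal.ofReal (2 ^ |δ|), by finiteness, fun f hf α hα x => ?_⟩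
  set V : EuclideanSpace ℝ (Fin d) → ℝ≥0∞ :=
    fun z => ENNReal.ofReal (∑ β ∈ mIdx d (k + n + 1), |mD β f z|)
  set W : EuclideanSpace ℝ (Fin d) → ℝ≥0∞ :=
    fun z => ENNReal.ofReal (∑ β ∈ mIdx d (k + n + 1), jb z ^ δ * |mD β f z|)
  have hV : Measurable V := ENNReal.measurable_ofReal.comp
    (continuous_finsetSum _ fun β hβ => (continuous_mD hf hβ).abs).measurable
  have h1 := hbound V hV (ENNReal.ofReal |mD α f x|) x fun y hy => by
    refine ofReal_abs_pdList_le hf _ ?_ x (mem_ball_zero_iff.1 hy).le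
    rw [length_multiIndexList]
    have := mem_mIdx.1 hα
    omega
  have hVW : ∀ z ∈ Metric.ball x 1,
      ENNReal.ofReal (jb x ^ δ) * V z ≤ ENNReal.ofReal (2 ^ |δ|) * W z := by
    intro z hz
    have hz' : ‖z - x‖ ≤ 1 := (mem_ball_iff_norm.1 hz).le
    rw [← ENNReal.ofReal_mul (Real.rpow_nonneg (jb_pos x).le _),
      ← ENNReal.ofReal_mul (by positivity)]
    refine ENNReal.ofReal_le_ofReal ?_
    rw [← Finset.mul_sum, ← mul_assoc]
    refine mul_le_mul_of_nonneg_right ?_ (Finset.sum_nonneg fun _ _ => abs_nonneg _)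
    exact rpow_le_two_rpow_abs_mul (jb_pos x) (jb_pos z)
      (jb_le_two_mul_jb (by rwa [norm_sub_rev])) (jb_le_two_mul_jb hz') δ
  have hmul (a : ℝ) (U : EuclideanSpace ℝ (Fin d) → ℝ≥0∞) :
      ENNReal.ofReal a * (∫⁻ y in Metric.ball x 1, U y ^ p) ^ (1 / p) =
        (∫⁻ y in Metric.ball x 1, (ENNReal.ofReal a * U y) ^ p) ^ (1 / p) := by
    simp_rw [ENNReal.mul_rpow_of_nonneg _ _ hp0.le]
    rw [lintegral_const_mul' _ _ (by finiteness),
      ENNReal.mul_rpow_of_nonneg _ _ (by positivity), ← ENNReal.rpow_mul,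
      mul_one_div_cancel hp0.ne', ENNReal.rpow_one]
  calc ENNReal.ofReal (jb x ^ δ * |mD α f x|)
      = ENNReal.ofReal (jb x ^ δ) * ENNReal.ofReal |mD α f x| :=
        ENNReal.ofReal_mul (Real.rpow_nonneg (jb_pos x).le _)
    _ ≤ ENNReal.ofReal (jb x ^ δ) * (C * (∫⁻ y in Metric.ball x 1, V y ^ p) ^ (1 / p)) := by
        gcongr
    _ = C * (∫⁻ y in Metric.ball x 1, (ENNReal.ofReal (jb x ^ δ) * V y) ^ p) ^ (1 / p) := by
        rw [mul_left_comm, hmul]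
    _ ≤ C * (∫⁻ y in Metric.ball x 1, (ENNReal.ofReal (2 ^ |δ|) * W y) ^ p) ^ (1 / p) := by
        gcongr C * ?_ ^ (1 / p)
        exact setLIntegral_mono' measurableSet_ball fun z hz =>
          ENNReal.rpow_le_rpow (hVW z hz) hp0.le
    _ = _ := by rw [← hmul, mul_assoc]

/-- Minkowski's inequality for a finite sum of nonnegative functions with integrable `p`-th
powers. -/
theorem lintegral_sum_rpow_le {X ι : Type*} [MeasurableSpace X] {μ : Measure X} {p : ℝ}
    (hp : 1 ≤ p) (t : Finset ι) {w : ι → X → ℝ} (hw0 : ∀ i ∈ t, ∀ z, 0 ≤ w i z)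
    (hwm : ∀ i ∈ t, AEStronglyMeasurable (w i) μ)
    (hw : ∀ i ∈ t, Integrable (fun z => w i z ^ p) μ) :
    (∫⁻ z, ENNReal.ofReal (∑ i ∈ t, w i z) ^ p ∂μ) ^ (1 / p) ≤
      ENNReal.ofReal (∑ i ∈ t, (∫ z, w i z ^ p ∂μ) ^ (1 / p)) := by
  have hp0 : 0 < p := by linarith
  have key {g : X → ℝ} (hg : ∀ z, 0 ≤ g z) :
      eLpNorm g (ENNReal.ofReal p) μ = (∫⁻ z, ENNReal.ofReal (g z) ^ p ∂μ) ^ (1 / p) := by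
    rw [eLpNorm_eq_lintegral_rpow_enorm_toReal (by simpa using hp0) ENNReal.ofReal_ne_top,
      ENNReal.toReal_ofReal hp0.le]
    simp_rw [Real.enorm_of_nonneg (hg _)]
  have h := eLpNorm_sum_le hwm (p := ENNReal.ofReal p) (by simpa using hp)
  rw [key fun z => by simpa using Finset.sum_nonneg fun i hi => hw0 i hi z] at h
  simp only [Finset.sum_apply] at h
  refine h.trans (le_of_eq ?_)
  have hint (i) (hi : i ∈ t) : 0 ≤ ∫ z, w i z ^ p ∂μ :=
    integral_nonneg fun z => Real.rpow_nonneg (hw0 i hi z) _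
  rw [ENNReal.ofReal_sum_of_nonneg fun i hi => Real.rpow_nonneg (hint i hi) _]
  refine Finset.sum_congr rfl fun i hi => ?_
  rw [key (hw0 i hi), ← ENNReal.ofReal_rpow_of_nonneg (hint i hi) (by positivity),
    ofReal_integral_eq_lintegral_ofReal (hw i hi)
      (ae_of_all _ fun z => Real.rpow_nonneg (hw0 i hi z) _)]
  simp_rw [ENNReal.ofReal_rpow_of_nonneg (hw0 i hi _) hp0.le]

/-- Integrals over unit balls of a function of finite integral vanish at infinity. -/
theorem tendsto_setLIntegral_ball_cocompact {d : ℕ} {F : EuclideanSpace ℝ (Fin d) → ℝ≥0∞}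
    (hF : Measurable F) (hfin : ∫⁻ z, F z ≠ ∞) :
    Tendsto (fun x => ∫⁻ z in Metric.ball x 1, F z) (cocompact (EuclideanSpace ℝ (Fin d)))
      (𝓝 0) := by
  have : (cocompact (EuclideanSpace ℝ (Fin d))).IsCountablyGenerated := by
    rw [← Metric.cobounded_eq_cocompact, ← comap_norm_atTop]
    infer_instance
  simp_rw [← lintegral_indicator measurableSet_ball]
  rw [← lintegral_zero (α := EuclideanSpace ℝ (Fin d)) (μ := volume)]
  refine tendsto_lintegral_filter_of_dominated_convergence F
    (Eventually.of_forall fun x => hF.indicator measurableSet_ball)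
    (Eventually.of_forall fun x => ae_of_all _ fun z => Set.indicator_le_self _ _ _) hfin
    (ae_of_all _ fun z => tendsto_const_nhds.congr' ?_)
  filter_upwards [(isCompact_closedBall z 1).compl_mem_cocompact] with x hx
  rw [Set.indicator_of_notMem]
  intro hz
  exact hx (Metric.mem_closedBall.2 (by rw [dist_comm]; exact (Metric.mem_ball.1 hz).le))

/-- Weighted Morrey-type estimate for `H^{m,p}_δ(ℝ^d)`: if `mp > d` and
`k < m - d/p`, then for `f ∈ C^m` with finite `H^{m,p}_δ` norm and any multi-index `α`
with `|α| ≤ k`, one has `sup_x ⟨x⟩^δ |D^α f(x)| ≤ C ‖f‖_{H^{m,p}_δ}` and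
`|x|^δ |D^α f(x)| → 0` as `|x| → ∞`. -/
theorem weighted_H_morrey_inequality
    (d m k : ℕ) (hd : 1 ≤ d) (p δ : ℝ) (hp : 1 < p)
    (hmp : (d : ℝ) < (m : ℝ) * p) (hk : (k : ℝ) < (m : ℝ) - (d : ℝ) / p) :
    ∃ C : ℝ, 0 < C ∧ ∀ f : EuclideanSpace ℝ (Fin d) → ℝ,
      ContDiff ℝ m f →
      (∀ β ∈ mIdx d m, Integrable (fun x => (jb x ^ δ * |mD β f x|) ^ p)) →
      ∀ α ∈ mIdx d k,
        (∀ x, jb x ^ δ * |mD α f x| ≤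
          C * ∑ β ∈ mIdx d m, (∫ x, (jb x ^ δ * |mD β f x|) ^ p) ^ (1 / p)) ∧
        Tendsto (fun x : EuclideanSpace ℝ (Fin d) => ‖x‖ ^ δ * |mD α f x|)
          (cocompact (EuclideanSpace ℝ (Fin d))) (𝓝 0) := by
  have hp0 : 0 < p := by linarith
  obtain ⟨C, hC, hloc⟩ := exists_local_weighted_bound (d := d) (m := m) (k := k) δ hp hk
  refine ⟨C.toReal + 1, by positivity, fun f hf hint α hα => ?_⟩
  set w : (Fin d → ℕ) → EuclideanSpace ℝ (Fin d) → ℝ := fun β z => jb z ^ δ * |mD β f z|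
  have hw0 (β z) : 0 ≤ w β z := mul_nonneg (Real.rpow_nonneg (jb_pos z).le _) (abs_nonneg _)
  have hwc (β) (hβ : β ∈ mIdx d m) : Continuous (w β) :=
    (continuous_jb_rpow δ).mul (continuous_mD hf hβ).abs
  set W : EuclideanSpace ℝ (Fin d) → ℝ≥0∞ := fun z => ENNReal.ofReal (∑ β ∈ mIdx d m, w β z)
  have hW : Measurable W := ENNReal.measurable_ofReal.comp (continuous_finsetSum _ hwc).measurable
  set S : ℝ := ∑ β ∈ mIdx d m, (∫ x, w β x ^ p) ^ (1 / p)
  have hS0 : 0 ≤ S := Finset.sum_nonneg fun β _ =>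
    Real.rpow_nonneg (integral_nonneg fun z => Real.rpow_nonneg (hw0 β z) _) _
  have hWS : (∫⁻ z, W z ^ p) ^ (1 / p) ≤ ENNReal.ofReal S :=
    lintegral_sum_rpow_le hp.le _ (fun β _ => hw0 β)
      (fun β hβ => (hwc β hβ).aestronglyMeasurable) hint
  have hfin : ∫⁻ z, W z ^ p ≠ ∞ := fun h => by
    rw [h, ENNReal.top_rpow_of_pos (by positivity)] at hWS
    exact ENNReal.ofReal_ne_top (top_le_iff.1 hWS)
  refine ⟨fun x => ?_, ?_⟩
  · have h : ENNReal.ofReal (w α x) ≤ ENNReal.ofReal (C.toReal * S) := by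
      rw [ENNReal.ofReal_mul ENNReal.toReal_nonneg, ENNReal.ofReal_toReal hC]
      refine (hloc f hf α hα x).trans (mul_le_mul_right ?_ C)
      refine le_trans ?_ hWS
      gcongr
      exact Measure.restrict_le_self
    rw [ENNReal.ofReal_le_ofReal_iff (by positivity)] at h
    exact h.trans (by nlinarith)
  · have hlim : Tendsto (fun x => C * (∫⁻ z in Metric.ball x 1, W z ^ p) ^ (1 / p))
        (cocompact (EuclideanSpace ℝ (Fin d))) (𝓝 0) := by
      have h := ENNReal.Tendsto.const_mul ((tendsto_setLIntegral_ball_cocompact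
        (hW.pow_const p) hfin).ennrpow_const (1 / p)) (Or.inr hC)
      rwa [ENNReal.zero_rpow_of_pos (by positivity), mul_zero] at h
    have hw : Tendsto (w α) (cocompact _) (𝓝 0) := by
      have h := (ENNReal.tendsto_toReal ENNReal.zero_ne_top).comp
        (tendsto_of_tendsto_of_tendsto_of_le_of_le tendsto_const_nhds hlim
          (fun x => zero_le) (hloc f hf α hα))
      exact h.congr fun x => ENNReal.toReal_ofReal (hw0 α x)
    have hw' : Tendsto (fun x => 2 ^ |δ| * w α x) (cocompact _) (𝓝 0) := by
      simpa using hw.const_mul (2 ^ |δ|)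
    refine squeeze_zero' (Eventually.of_forall fun x => by positivity) ?_ hw'
    filter_upwards [(tendsto_norm_cocompact_atTop
      (E := EuclideanSpace ℝ (Fin d))).eventually_ge_atTop 1] with x hx
    rw [← mul_assoc]
    refine mul_le_mul_of_nonneg_right ?_ (abs_nonneg _)
    exact rpow_le_two_rpow_abs_mul (by linarith) (jb_pos x)
      ((norm_le_jb x).trans (by linarith [jb_pos x])) (jb_le_two_mul_norm hx) δ
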